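/- Let ψ ∈ Aut(F) be a 1-involution with a canonical basis V ⊔ {x} ⊔ Y such that ψx = x⁻¹, ψy = x y x⁻¹ for all y ∈ Y, and ψv = v for all v ∈ V, where |Y| + 1 ≤ |V| and Y is infinite. Then the product set L·L, where L is the conjugacy class of ψ̂ in Out(F), contains infinitely many conjugacy classes of soft involutions of Out(F); in particular, L·L contains more than one conjugacy class of involutions. -/

import Mathlib

open Pointwise

/-- A subset `S` of a free group is a basis if the canonical homomorphism
`FreeGroup S →* FreeGroup X` extending the inclusion is bijective. -/
def FreeGroup.IsBasis {X : Type*} (S : Set (FreeGroup X)) : Prop :=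
  Function.Bijective (FreeGroup.lift (fun s : S => (s : FreeGroup X)))

/-- The subgroup of inner automorphisms of a group `G`, as a subgroup of `MulAut G`. -/
def Inn (G : Type*) [Group G] : Subgroup (MulAut G) :=
  (MulAut.conj : G →* MulAut G).range

instance Inn.normal (G : Type*) [Group G] : (Inn G).Normal := by
  constructor
  rintro - ⟨g, rfl⟩ σ
  refine ⟨σ g, ?_⟩
  ext x
  simp [MulAut.conj, MulAut.mul_apply, mul_assoc]

/-- The outer automorphism group `Out G = Aut G / Inn G`. -/
abbrev OutAut (G : Type*) [Group G] := MulAut G ⧸ Inn G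

/-- The natural homomorphism `Aut G → Out G`. -/
def toOut {G : Type*} [Group G] : MulAut G →* OutAut G :=
  QuotientGroup.mk' (Inn G)

/-- `g` is an involution of the group `G`. -/
def IsInvolution {G : Type*} [Group G] (g : G) : Prop :=
  g ≠ 1 ∧ g ^ 2 = 1

/-- A subset of a group is anti-commutative if its elements pairwise do not commute. -/
def AntiCommSet {G : Type*} [Group G] (s : Set G) : Prop :=
  ∀ a ∈ s, ∀ b ∈ s, a ≠ b → a * b ≠ b * a

/-- A decomposition `U ⊔ S ⊔ ⊔_{x ∈ S} Y x` of a basis of a free group. -/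
structure IsBasisDecomposition {X : Type*} (U S : Set (FreeGroup X))
    (Y : FreeGroup X → Set (FreeGroup X)) : Prop where
  isBasis : FreeGroup.IsBasis (U ∪ S ∪ ⋃ x ∈ S, Y x)
  disjUS : Disjoint U S
  disjUY : ∀ x ∈ S, Disjoint U (Y x)
  disjSY : ∀ x ∈ S, Disjoint S (Y x)
  disjYY : ∀ x ∈ S, ∀ x' ∈ S, x ≠ x' → Disjoint (Y x) (Y x')

/-- `U ⊔ S ⊔ ⊔_{x ∈ S} Y x` is a canonical basis for the (soft) involution `φ`:
`φ` fixes `U` pointwise, inverts the elements of `S` and conjugates the elements of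
`Y x` by `x`. -/
def IsCanonicalBasis {X : Type*} (φ : MulAut (FreeGroup X)) (U S : Set (FreeGroup X))
    (Y : FreeGroup X → Set (FreeGroup X)) : Prop :=
  IsBasisDecomposition U S Y ∧
    (∀ u ∈ U, φ u = u) ∧ (∀ x ∈ S, φ x = x⁻¹) ∧
    (∀ x ∈ S, ∀ y ∈ Y x, φ y = x * y * x⁻¹)

/-- A soft involution of `Aut F`: an involution admitting a canonical basis. -/
def IsSoftInvolution {X : Type*} (φ : MulAut (FreeGroup X)) : Prop :=
  IsInvolution φ ∧ ∃ U S Y, IsCanonicalBasis φ U S Y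

/-- A soft involution of `Out F`: an involution induced by a soft involution of `Aut F`. -/
def IsSoftOutInvolution {X : Type*} (f : OutAut (FreeGroup X)) : Prop :=
  IsInvolution f ∧ ∃ φ, IsSoftInvolution φ ∧ toOut φ = f

/-- A `1`-involution of `Aut F`: a soft involution whose canonical bases have exactly
one block. -/
def IsOneInvolution {X : Type*} (ψ : MulAut (FreeGroup X)) : Prop :=
  IsInvolution ψ ∧ ∃ (U Y : Set (FreeGroup X)) (x : FreeGroup X),
    IsCanonicalBasis ψ U {x} (fun _ => Y)

/-- A `1`-involution of `Out F`: an involution induced by a `1`-involution of `Aut F`. -/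
def IsOneOutInvolution {X : Type*} (f : OutAut (FreeGroup X)) : Prop :=
  IsInvolution f ∧ ∃ ψ, IsOneInvolution ψ ∧ toOut ψ = f

/-- An extremal involution of `Aut F`: an involution inverting one element of a suitable
basis and fixing all other elements of that basis. -/
def IsExtremalInvolution {X : Type*} (φ : MulAut (FreeGroup X)) : Prop :=
  IsInvolution φ ∧ ∃ (B : Set (FreeGroup X)) (x : FreeGroup X),
    FreeGroup.IsBasis B ∧ x ∈ B ∧ φ x = x⁻¹ ∧ ∀ b ∈ B, b ≠ x → φ b = b

/-- An extremal involution of `Out F`: an involution induced by an extremal involution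
of `Aut F`. -/
def IsExtremalOutInvolution {X : Type*} (f : OutAut (FreeGroup X)) : Prop :=
  IsInvolution f ∧ ∃ φ, IsExtremalInvolution φ ∧ toOut φ = f

/-- A symmetry of `Aut F`: an involution inverting all elements of some basis. -/
def IsSymmetryAut {X : Type*} (θ : MulAut (FreeGroup X)) : Prop :=
  IsInvolution θ ∧ ∃ B : Set (FreeGroup X), FreeGroup.IsBasis B ∧ ∀ b ∈ B, θ b = b⁻¹

/-- A symmetry of `Out F`: an involution whose full preimage in `Aut F` contains a
symmetry. -/
def IsSymmetryOut {X : Type*} (f : OutAut (FreeGroup X)) : Prop :=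
  IsInvolution f ∧ ∃ θ, IsSymmetryAut θ ∧ toOut θ = f

/-- Condition (★): the product set `K·K` contains exactly one conjugacy class of
involutions, and no element of `K` is a square. -/
def StarCondition {G : Type*} [Group G] (K : Set G) : Prop :=
  (∃ c ∈ K * K, IsInvolution c ∧ ∀ d ∈ K * K, IsInvolution d → IsConj c d) ∧
    ∀ k ∈ K, ¬ ∃ g : G, g ^ 2 = k

namespace FreeGroup

section Parity

variable {J K : Type*}

/-- The exponent sums modulo `2` of the generators. -/
noncomputable def parity : FreeGroup J →* Multiplicative (J →₀ ZMod 2) :=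
  lift fun j => Multiplicative.ofAdd (Finsupp.single j 1)

/-- The exponent sum of the generator `j`. -/
noncomputable def exponent (j : J) : FreeGroup J →* Multiplicative ℤ :=
  lift fun k => Multiplicative.ofAdd (Finsupp.single k (1 : ℤ) j)

/-- The exponent sum modulo `2` of the generator `j`. -/
noncomputable def parityAt (j : J) : FreeGroup J →* Multiplicative (ZMod 2) :=
  (AddMonoidHom.toMultiplicative (Finsupp.applyAddHom j)).comp parity

@[simp]
lemma parity_of (j : J) : parity (of j) = Multiplicative.ofAdd (Finsupp.single j 1) := by
  simp [parity]

lemma parityAt_of (j k : J) :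
    parityAt j (of k) = Multiplicative.ofAdd (Finsupp.single k (1 : ZMod 2) j) := by
  simp [parityAt]

@[simp]
lemma parityAt_of_self (j : J) : parityAt j (of j) = Multiplicative.ofAdd 1 := by
  simp [parityAt_of]

lemma parityAt_of_ne {j k : J} (h : k ≠ j) : parityAt j (of k) = 1 := by
  simp [parityAt_of, Finsupp.single_eq_of_ne' h]

lemma parity_eq_one_iff (a : FreeGroup J) : parity a = 1 ↔ ∀ j, parityAt j a = 1 := by
  constructor
  · intro h j
    simp [parityAt, h]
  · intro h
    apply Multiplicative.toAdd.injective
    ext j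
    exact congrArg Multiplicative.toAdd (h j)

lemma exponent_of_self (j : J) : exponent j (of j) = Multiplicative.ofAdd 1 := by
  simp [exponent]

lemma exponent_of_ne {j k : J} (h : k ≠ j) : exponent j (of k) = 1 := by
  simp [exponent, Finsupp.single_eq_of_ne' h]

lemma parityAt_eq_exponent (j : J) (a : FreeGroup J) :
    parityAt j a = Multiplicative.ofAdd (((exponent j a).toAdd : ℤ) : ZMod 2) := by
  have : parityAt j =
      (AddMonoidHom.toMultiplicative (Int.castAddHom (ZMod 2))).comp (exponent j) := by
    ext k
    by_cases h : k = j
    · subst h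
      simp [exponent_of_self]
    · simp [exponent_of_ne h, parityAt_of_ne h]
  rw [this]
  rfl

lemma parityAt_eq_one_of_even {j : J} {a : FreeGroup J}
    (h : (2 : ℤ) ∣ (exponent j a).toAdd) : parityAt j a = 1 := by
  rw [parityAt_eq_exponent]
  have := (ZMod.intCast_zmod_eq_zero_iff_dvd (exponent j a).toAdd 2).2 (by exact_mod_cast h)
  rw [this]
  rfl

/-- Every homomorphism to a group of order two factors through `parity`. -/
lemma map_eq_one_of_parity_eq_one (χ : FreeGroup J →* Multiplicative (ZMod 2))
    {a : FreeGroup J} (ha : parity a = 1) : χ a = 1 := by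
  have : χ = (AddMonoidHom.toMultiplicative (Finsupp.liftAddHom fun j =>
      AddMonoidHom.mulLeft (χ (of j)).toAdd)).comp parity := by
    ext j
    simp
  rw [this]
  simp [ha]

lemma parity_map_eq_one (θ : FreeGroup J →* FreeGroup K) {a : FreeGroup J}
    (ha : parity a = 1) : parity (θ a) = 1 :=
  (parity_eq_one_iff _).2 fun k => map_eq_one_of_parity_eq_one ((parityAt k).comp θ) ha

lemma map_ker_parity (θ : FreeGroup J ≃* FreeGroup K) :
    (parity (J := J)).ker.map θ.toMonoidHom = (parity (J := K)).ker := by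
  ext b
  constructor
  · rintro ⟨a, ha, rfl⟩
    exact parity_map_eq_one θ.toMonoidHom ha
  · intro hb
    exact ⟨θ.symm b, parity_map_eq_one θ.symm.toMonoidHom hb, θ.apply_symm_apply b⟩

open Classical in
/-- A central element of a free group of rank at least two has all exponent sums zero. -/
lemma exponent_eq_one_of_conj_eq_one {J : Type*} [Nontrivial J] {g : FreeGroup J}
    (hg : MulAut.conj g = 1) (j : J) : exponent j g = 1 := by
  let scale : ℚˣ := Units.mk0 2 two_ne_zero
  let h : FreeGroup J →* (ℚ ≃ᵃ[ℚ] ℚ) := lift fun k =>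
    if k = j then (DistribMulAction.toModuleAut ℚ ℚ scale).toAffineEquiv else AffineEquiv.constVAdd ℚ ℚ 1
  have hlin : AffineEquiv.linearHom.comp h =
      ((DistribMulAction.toModuleAut ℚ ℚ).comp (zpowersHom ℚˣ scale)).comp (exponent j) := by
    ext1 k
    by_cases hk : k = j
    · subst hk
      ext
      simp [h, exponent_of_self]
      rfl
    · ext
      simp [h, hk, exponent_of_ne hk]
  obtain ⟨k, hk⟩ := exists_ne j
  have hcomm : h g * h (of k) = h (of k) * h g := by
    rw [← _root_.map_mul, ← _root_.map_mul]
    exact congrArg h (mul_inv_eq_iff_eq_mul.1 (DFunLike.congr_fun hg (of k)))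
  have hk' : h (of k) = AffineEquiv.constVAdd ℚ ℚ 1 := by simp [h, hk]
  have h0 := DFunLike.congr_fun hcomm 0
  rw [hk'] at h0
  have hone : (h g).linear 1 = 1 := by
    have h1 := (h g).map_vadd 0 1
    simp at h0 h1
    linarith
  have hlin1 := DFunLike.congr_fun (DFunLike.congr_fun hlin g) 1
  have hpow : (2 : ℚ) ^ (exponent j g).toAdd = 1 := by
    rw [← hone]
    refine Eq.trans ?_ hlin1.symm
    simp [scale, zpowersHom_apply, Units.smul_def]
  have := (zpow_eq_one_iff_right₀ (by norm_num : (0:ℚ) ≤ 2) (by norm_num)).1 hpow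
  exact Multiplicative.toAdd.injective this

end Parity

section Dihedral

variable {J K : Type*}

/-- The character of the dihedral group of order `8` sending `sr 0` to `1` and `sr 1` to `0`. -/
def dihedralFst : DihedralGroup 4 →* Multiplicative (ZMod 2) where
  toFun
    | .r i => Multiplicative.ofAdd (i.cast)
    | .sr i => Multiplicative.ofAdd (1 + i.cast)
  map_one' := by decide
  map_mul' := by decide

/-- The character of the dihedral group of order `8` sending `sr 0` to `0` and `sr 1` to `1`. -/
def dihedralSnd : DihedralGroup 4 →* Multiplicative (ZMod 2) where
  toFun
    | .r i => Multiplicative.ofAdd (i.cast)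
    | .sr i => Multiplicative.ofAdd (i.cast)
  map_one' := by decide
  map_mul' := by decide

lemma dihedral_central : ∀ g : DihedralGroup 4, dihedralFst g = 1 → dihedralSnd g = 1 →
    ∀ p, g * p * g⁻¹ = p := by
  decide

lemma dihedral_fst_eq_one : ∀ g p : DihedralGroup 4, dihedralFst p = 1 → dihedralSnd p ≠ 1 →
    g * p * g⁻¹ = p → dihedralFst g = 1 := by
  decide

lemma dihedral_conj_of_parity_eq_one (h : FreeGroup J →* DihedralGroup 4) {w : FreeGroup J}
    (hw : parity w = 1) (p : DihedralGroup 4) : h w * p * (h w)⁻¹ = p :=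
  dihedral_central _ (map_eq_one_of_parity_eq_one (dihedralFst.comp h) hw)
    (map_eq_one_of_parity_eq_one (dihedralSnd.comp h) hw) p

/-- The elements whose images under all homomorphisms to the dihedral group of order `8`
are unchanged by `φ`. -/
def dihedralFixed (φ : MulAut (FreeGroup J)) : Subgroup (FreeGroup J) where
  carrier := {a | ∀ h : FreeGroup J →* DihedralGroup 4, h (φ a) = h a}
  one_mem' := by simp
  mul_mem' := by
    intro a b ha hb h
    simp [ha h, hb h]
  inv_mem' := by
    intro a ha h
    simp [ha h]

lemma dihedralFixed_congr (θ : FreeGroup J ≃* FreeGroup K) (φ : MulAut (FreeGroup J)) :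
    dihedralFixed (MulAut.congr θ φ) = (dihedralFixed φ).map θ.toMonoidHom := by
  ext b
  constructor
  · intro hb
    refine ⟨θ.symm b, fun h => ?_, θ.apply_symm_apply b⟩
    simpa [MulAut.congr] using hb (h.comp θ.symm.toMonoidHom)
  · rintro ⟨a, ha, rfl⟩ h
    simpa [MulAut.congr] using ha (h.comp θ.toMonoidHom)

lemma card_map_parity_dihedralFixed_congr (θ : FreeGroup J ≃* FreeGroup K)
    (φ : MulAut (FreeGroup J)) :
    Nat.card ((dihedralFixed (MulAut.congr θ φ)).map parity) =
      Nat.card ((dihedralFixed φ).map parity) := by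
  rw [← Subgroup.relIndex_ker, ← Subgroup.relIndex_ker, dihedralFixed_congr,
    ← map_ker_parity θ]
  exact Subgroup.relIndex_map_map_of_injective _ _ θ.injective

end Dihedral

end FreeGroup

/-- Index type of a canonical basis with fixed part `N` and blocks `{p} ∪ A p`, `p : P`. -/
inductive SoftIndex (P : Type*) (N : Type*) (A : P → Type*)
  | fix : N → SoftIndex P N A
  | pt : P → SoftIndex P N A
  | blk : (p : P) → A p → SoftIndex P N A

namespace SoftIndex

open FreeGroup

variable {P N : Type*} {A : P → Type*}

/-- The endomorphism fixing `fix u`, inverting `pt p`, and conjugating `blk p y` by `pt p`. -/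
def softHom (P N : Type*) (A : P → Type*) :
    FreeGroup (SoftIndex P N A) →* FreeGroup (SoftIndex P N A) :=
  lift fun
    | fix u => of (fix u)
    | pt p => (of (pt p))⁻¹
    | blk p y => of (pt p) * of (blk p y) * (of (pt p))⁻¹

lemma softHom_comp_self : (softHom P N A).comp (softHom P N A) = MonoidHom.id _ := by
  ext j
  cases j <;> simp [softHom, mul_assoc]

/-- The soft involution whose canonical basis is indexed by `SoftIndex P N A`. -/
def soft (P N : Type*) (A : P → Type*) : MulAut (FreeGroup (SoftIndex P N A)) :=
  (softHom P N A).toMulEquiv (softHom P N A) softHom_comp_self softHom_comp_self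

@[simp]
lemma soft_fix (u : N) : soft P N A (of (fix u)) = of (fix u) := by
  simp [soft, softHom]

@[simp]
lemma soft_pt (p : P) : soft P N A (of (pt p)) = (of (pt p))⁻¹ := by
  simp [soft, softHom]

@[simp]
lemma soft_blk (p : P) (y : A p) :
    soft P N A (of (blk p y)) = of (pt p) * of (blk p y) * (of (pt p))⁻¹ := by
  simp [soft, softHom]

lemma soft_sq : soft P N A ^ 2 = 1 := by
  ext1 a
  rw [sq]
  exact DFunLike.congr_fun softHom_comp_self a

lemma exponent_pt_soft (p : P) (a : FreeGroup (SoftIndex P N A)) :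
    exponent (pt p) (soft P N A a) = (exponent (pt p) a)⁻¹ := by
  have : (exponent (pt p)).comp (soft P N A).toMonoidHom =
      (MonoidHom.id (Multiplicative ℤ))⁻¹.comp (exponent (pt p)) := by
    ext1 j
    cases j <;> simp [exponent_of_ne]
  exact DFunLike.congr_fun this a

lemma exponent_fix_soft (u : N) (a : FreeGroup (SoftIndex P N A)) :
    exponent (fix u) (soft P N A a) = exponent (fix u) a := by
  have : (exponent (fix u)).comp (soft P N A).toMonoidHom = exponent (fix u) := by
    ext1 j
    cases j <;> simp [exponent_of_ne]
  exact DFunLike.congr_fun this a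

lemma exponent_blk_soft (p : P) (y : A p) (a : FreeGroup (SoftIndex P N A)) :
    exponent (blk p y) (soft P N A a) = exponent (blk p y) a := by
  have : (exponent (blk p y)).comp (soft P N A).toMonoidHom = exponent (blk p y) := by
    ext1 j
    cases j <;> simp [exponent_of_ne]
  exact DFunLike.congr_fun this a

lemma toOut_soft_ne_one [Nonempty P] : toOut (soft P N A) ≠ 1 := by
  intro h
  obtain ⟨g, hg⟩ := (QuotientGroup.eq_one_iff _).1 h
  obtain ⟨p⟩ := ‹Nonempty P›
  have h1 := exponent_pt_soft p (of (pt p) : FreeGroup (SoftIndex P N A))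
  rw [← hg, MulAut.conj_apply, _root_.map_mul, _root_.map_mul, _root_.map_inv, exponent_of_self,
    mul_inv_cancel_comm] at h1
  exact absurd h1 (by decide)

lemma parityAt_eq_one_of_sq_eq_one [Nonempty P] [Nontrivial (SoftIndex P N A)]
    {w : FreeGroup (SoftIndex P N A)} (hw : (MulAut.conj w * soft P N A) ^ 2 = 1)
    {q : SoftIndex P N A} (hq : ∀ p, q ≠ pt p) : parityAt q w = 1 := by
  have hconj : MulAut.conj (w * soft P N A w) = 1 := by
    rw [← hw]
    ext1 a
    have ha : soft P N A (soft P N A a) = a := DFunLike.congr_fun soft_sq a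
    simp [sq, mul_assoc, ha]
  have hexp := exponent_eq_one_of_conj_eq_one hconj q
  apply parityAt_eq_one_of_even
  have hfix : exponent q (soft P N A w) = exponent q w := by
    cases q with
    | fix u => exact exponent_fix_soft u w
    | pt p => exact absurd rfl (hq p)
    | blk p y => exact exponent_blk_soft p y w
  rw [_root_.map_mul, hfix] at hexp
  have h2 : (exponent q w).toAdd + (exponent q w).toAdd = 0 := congrArg Multiplicative.toAdd hexp
  omega

lemma parityAt_pt_eq_one {w a : FreeGroup (SoftIndex P N A)}
    (ha : a ∈ dihedralFixed (MulAut.conj w * soft P N A)) (p : P) : parityAt (pt p) a = 1 := by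
  apply parityAt_eq_one_of_even
  have h := ha ((zpowersHom (DihedralGroup 4) (.r 1)).comp (exponent (pt p)))
  have hexp : exponent (pt p) ((MulAut.conj w * soft P N A) a) = (exponent (pt p) a)⁻¹ := by
    simp [exponent_pt_soft]
  rw [MonoidHom.comp_apply, hexp, MonoidHom.comp_apply, _root_.map_inv, inv_eq_iff_mul_eq_one,
    ← _root_.map_mul, zpowersHom_apply, ← orderOf_dvd_iff_zpow_eq_one,
    DihedralGroup.orderOf_r_one, toAdd_mul] at h
  omega

open Classical in
/-- An odd exponent of `a` at `q` forces the parity of `w` at every `pt p`. -/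
lemma parityAt_pt_conjugator {w a : FreeGroup (SoftIndex P N A)}
    (ha : a ∈ dihedralFixed (MulAut.conj w * soft P N A)) {q : SoftIndex P N A}
    (hq : parityAt q a ≠ 1) (p : P) :
    parityAt (pt p) w = if ∃ y, q = blk p y then Multiplicative.ofAdd 1 else 1 := by
  have hqpt : ∀ p, q ≠ pt p := by
    rintro p rfl
    exact hq (parityAt_pt_eq_one ha p)
  let h : FreeGroup (SoftIndex P N A) →* DihedralGroup 4 := lift fun j =>
    if j = pt p then .sr 0 else if j = q then .sr 1 else 1
  have hpt : h (of (pt p)) = .sr 0 := by simp [h]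
  have hqv : h (of q) = .sr 1 := by simp [h, hqpt p]
  have hother : ∀ j, j ≠ pt p → j ≠ q → h (of j) = 1 := by
    intro j h1 h2
    simp [h, h1, h2]
  have hfst : dihedralFst.comp h = parityAt (pt p) := by
    ext1 j
    by_cases h1 : j = pt p
    · subst h1
      simp [hpt]
      decide
    · by_cases h2 : j = q
      · subst h2
        simp [hqv, parityAt_of_ne h1]
        decide
      · simp [hother j h1 h2, parityAt_of_ne h1]
  have hsnd : dihedralSnd.comp h = parityAt q := by
    ext1 j
    by_cases h1 : j = pt p
    · subst h1
      simp [hpt, parityAt_of_ne (hqpt p).symm]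
      decide
    · by_cases h2 : j = q
      · subst h2
        simp [hqv]
        decide
      · simp [hother j h1 h2, parityAt_of_ne h2]
  let e : DihedralGroup 4 := if ∃ y, q = blk p y then .sr 0 else 1
  have hsoft : h.comp (soft P N A).toMonoidHom = (MulAut.conj e).toMonoidHom.comp h := by
    ext1 j
    cases j with
    | fix u =>
      by_cases h2 : fix u = q
      · subst h2
        simp [e]
      · simp [hother (fix u) (by simp) h2]
    | pt p' =>
      by_cases h2 : p' = p
      · subst h2
        simp only [MonoidHom.comp_apply, MulEquiv.toMonoidHom_eq_coe, MonoidHom.coe_coe, soft_pt,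
          _root_.map_inv, hpt, MulAut.conj_apply, e]
        split_ifs <;> decide
      · simp [hother (pt p') (by simpa using h2) (hqpt p').symm]
    | blk p' y =>
      by_cases h2 : blk p' y = q
      · subst h2
        by_cases h3 : p' = p
        · subst h3
          simp [e, hpt]
        · have h5 : h (of (pt p')) = 1 := hother _ (by simpa using h3) (hqpt p').symm
          simp [e, h3, h5]
      · simp [hother (blk p' y) (by simp) h2]
  have hsoft' : h (soft P N A a) = e * h a * e⁻¹ := DFunLike.congr_fun hsoft a
  have hfix : (h w * e) * h a * (h w * e)⁻¹ = h a := by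
    have := ha h
    simp only [MulAut.mul_apply, MulAut.conj_apply, _root_.map_mul, _root_.map_inv, hsoft'] at this
    simpa [mul_assoc] using this
  have hres := dihedral_fst_eq_one _ _
    ((DFunLike.congr_fun hfst a).trans (parityAt_pt_eq_one ha p))
    (by rw [← MonoidHom.comp_apply, hsnd]; exact hq) hfix
  rw [_root_.map_mul, ← MonoidHom.comp_apply, hfst] at hres
  rw [eq_inv_of_mul_eq_one_left hres]
  simp only [e]
  split_ifs <;> decide

lemma parity_eq_one_of_conjugator [Nonempty P] [Nontrivial (SoftIndex P N A)]
    {w : FreeGroup (SoftIndex P N A)} (hw : (MulAut.conj w * soft P N A) ^ 2 = 1)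
    (hpt : ∀ p, parityAt (pt p) w = 1) : parity w = 1 := by
  refine (parity_eq_one_iff w).2 fun q => ?_
  cases q with
  | fix u => exact parityAt_eq_one_of_sq_eq_one hw (by simp)
  | pt p => exact hpt p
  | blk p y => exact parityAt_eq_one_of_sq_eq_one hw (by simp)

lemma card_map_parity_of_parity_eq_one [Fintype N] {w : FreeGroup (SoftIndex P N A)}
    (hw : parity w = 1) :
    Nat.card ((dihedralFixed (MulAut.conj w * soft P N A)).map parity) = 2 ^ Fintype.card N := by
  classical
  set D := dihedralFixed (MulAut.conj w * soft P N A)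
  have hfix_inj : Function.Injective (fix : N → SoftIndex P N A) := fun _ _ h => by cases h; rfl
  have hmem : ∀ u, of (fix u) ∈ D := by
    intro u h
    simpa using dihedral_conj_of_parity_eq_one h hw _
  have hmap : ∀ v : N →₀ ZMod 2, Multiplicative.ofAdd (Finsupp.mapDomain fix v) ∈ D.map parity := by
    intro v
    induction v using Finsupp.induction_linear with
    | zero => simp
    | add v v' hv hv' =>
      rw [Finsupp.mapDomain_add, ofAdd_add]
      exact mul_mem hv hv'
    | single u c =>
      refine ⟨of (fix u) ^ c.val, pow_mem (hmem u) _, ?_⟩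
      rw [_root_.map_pow, parity_of, ← ofAdd_nsmul, Finsupp.mapDomain_single,
        Finsupp.smul_single]
      simp
  have hbij : Function.Bijective fun v : N →₀ ZMod 2 =>
      (⟨_, hmap v⟩ : D.map parity) := by
    constructor
    · intro v v' h
      exact Finsupp.mapDomain_injective hfix_inj
        (Multiplicative.ofAdd.injective (congrArg Subtype.val h))
    · rintro ⟨_, a, ha, rfl⟩
      refine ⟨Finsupp.comapDomain fix (parity a).toAdd hfix_inj.injOn, Subtype.ext ?_⟩
      apply Multiplicative.toAdd.injective
      refine Finsupp.mapDomain_comapDomain fix hfix_inj _ fun q hq => ?_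
      have hq' : parityAt q a ≠ 1 := fun h =>
        Finsupp.mem_support_iff.1 hq (congrArg Multiplicative.toAdd h)
      cases q with
      | fix u => exact ⟨u, rfl⟩
      | pt p => exact absurd (parityAt_pt_eq_one ha p) hq'
      | blk p y =>
        have h := parityAt_pt_conjugator ha hq' p
        rw [if_pos ⟨y, rfl⟩, (parity_eq_one_iff w).1 hw] at h
        exact absurd h (by decide)
  rw [← Nat.card_congr (Equiv.ofBijective _ hbij), Nat.card_congr Finsupp.equivFunOnFinite]
  simp [Nat.card_eq_fintype_card]

lemma card_map_parity_cases [Nonempty P] [∀ p, Infinite (A p)] [Fintype N]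
    {w : FreeGroup (SoftIndex P N A)} (hw : (MulAut.conj w * soft P N A) ^ 2 = 1) :
    Nat.card ((dihedralFixed (MulAut.conj w * soft P N A)).map parity) = 0 ∨
    Nat.card ((dihedralFixed (MulAut.conj w * soft P N A)).map parity) = 1 ∨
    Nat.card ((dihedralFixed (MulAut.conj w * soft P N A)).map parity) = 2 ^ Fintype.card N := by
  classical
  obtain ⟨p₀⟩ := ‹Nonempty P›
  have : Nontrivial (SoftIndex P N A) :=
    ⟨pt p₀, blk p₀ (Classical.arbitrary _), by simp⟩
  by_cases hD : ∀ a ∈ dihedralFixed (MulAut.conj w * soft P N A), parity a = 1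
  · right; left
    rw [Subgroup.card_eq_one, eq_bot_iff]
    rintro _ ⟨a, ha, rfl⟩
    exact hD a ha
  push Not at hD
  obtain ⟨a, ha, hne⟩ := hD
  rw [ne_eq, parity_eq_one_iff] at hne
  push Not at hne
  obtain ⟨q, hq⟩ := hne
  cases q with
  | fix u =>
    right; right
    refine card_map_parity_of_parity_eq_one (parity_eq_one_of_conjugator hw fun p => ?_)
    simpa using parityAt_pt_conjugator ha hq p
  | pt p => exact absurd (parityAt_pt_eq_one ha p) hq
  | blk p y =>
    left
    have hwp : parity (w * of (pt p)) = 1 := by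
      refine (parity_eq_one_iff _).2 fun q => ?_
      rw [_root_.map_mul]
      cases q with
      | fix u => rw [parityAt_eq_one_of_sq_eq_one hw (by simp), parityAt_of_ne (by simp), one_mul]
      | blk p' y' =>
        rw [parityAt_eq_one_of_sq_eq_one hw (by simp), parityAt_of_ne (by simp), one_mul]
      | pt p' =>
        rw [parityAt_pt_conjugator ha hq p']
        by_cases h : p = p'
        · subst h
          simp
          decide
        · rw [parityAt_of_ne (by simpa using h), if_neg, one_mul]
          rintro ⟨y', h'⟩
          exact h (by cases h'; rfl)
    have hmem : ∀ z : A p, of (blk p z) ∈ dihedralFixed (MulAut.conj w * soft P N A) := by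
      intro z h
      simpa [mul_assoc] using dihedral_conj_of_parity_eq_one h hwp (h (of (blk p z)))
    have hinf : Infinite ((dihedralFixed (MulAut.conj w * soft P N A)).map parity) := by
      refine Infinite.of_injective
        (fun z : A p => (⟨parity (of (blk p z)), _, hmem z, rfl⟩ :
          (dihedralFixed (MulAut.conj w * soft P N A)).map parity)) fun z z' h => ?_
      have h' := congrArg Subtype.val h
      simp only [parity_of] at h'
      have h'' := Finsupp.single_left_injective one_ne_zero (Multiplicative.ofAdd.injective h')
      cases h''
      rfl
    exact Nat.card_eq_zero_of_infinite

/-- The finite rank of the fixed part is an invariant of the outer class. -/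
theorem card_fixed_part_eq {P' N' : Type*} {A' : P' → Type*} [Nonempty P'] [Fintype N] [Fintype N']
    [Nonempty N] [∀ p, Infinite (A' p)]
    (θ : FreeGroup (SoftIndex P N A) ≃* FreeGroup (SoftIndex P' N' A'))
    {w : FreeGroup (SoftIndex P' N' A')}
    (h : MulAut.congr θ (soft P N A) = MulAut.conj w * soft P' N' A') :
    Fintype.card N = Fintype.card N' := by
  have hw : (MulAut.conj w * soft P' N' A') ^ 2 = 1 := by
    rw [← h, ← _root_.map_pow, soft_sq, _root_.map_one]
  have hcard := card_map_parity_dihedralFixed_congr θ (soft P N A)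
  have hone := card_map_parity_of_parity_eq_one (P := P) (N := N) (A := A) (_root_.map_one parity)
  rw [_root_.map_one, one_mul] at hone
  rw [hone, h] at hcard
  have hpos : Fintype.card N ≠ 0 := Fintype.card_ne_zero
  rcases card_map_parity_cases hw with h0 | h0 | h0 <;> rw [hcard] at h0
  · simp at h0
  · simp [hpos] at h0
  · exact Nat.pow_right_injective le_rfl h0

end SoftIndex

namespace FreeGroup

section OneBlock

variable {J K : Type*}

open Classical in
/-- The endomorphism inverting the generator `x`, conjugating the generators in `T` by `x` and
fixing the other ones. -/
noncomputable def oneBlockHom (x : J) (T : Set J) : FreeGroup J →* FreeGroup J :=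
  lift fun j => if j = x then (of x)⁻¹ else if j ∈ T then of x * of j * (of x)⁻¹ else of j

lemma oneBlockHom_self (x : J) (T : Set J) : oneBlockHom x T (of x) = (of x)⁻¹ := by
  simp [oneBlockHom]

lemma oneBlockHom_of_mem {x j : J} {T : Set J} (hx : j ≠ x) (hT : j ∈ T) :
    oneBlockHom x T (of j) = of x * of j * (of x)⁻¹ := by
  simp [oneBlockHom, hx, hT]

lemma oneBlockHom_of_notMem {x j : J} {T : Set J} (hx : j ≠ x) (hT : j ∉ T) :
    oneBlockHom x T (of j) = of j := by
  simp [oneBlockHom, hx, hT]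

lemma oneBlockHom_comp_self (x : J) (T : Set J) :
    (oneBlockHom x T).comp (oneBlockHom x T) = MonoidHom.id _ := by
  ext1 j
  by_cases hx : j = x
  · subst hx
    simp [oneBlockHom_self]
  · by_cases hT : j ∈ T
    · simp [oneBlockHom_of_mem hx hT, oneBlockHom_self, mul_assoc]
    · simp [oneBlockHom_of_notMem hx hT]

/-- The `1`-involution with block `{x} ∪ T`. -/
noncomputable def oneBlock (x : J) (T : Set J) : MulAut (FreeGroup J) :=
  (oneBlockHom x T).toMulEquiv (oneBlockHom x T) (oneBlockHom_comp_self x T)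
    (oneBlockHom_comp_self x T)

@[simp]
lemma oneBlock_self (x : J) (T : Set J) : oneBlock x T (of x) = (of x)⁻¹ :=
  oneBlockHom_self x T

lemma oneBlock_of_mem {x j : J} {T : Set J} (hx : j ≠ x) (hT : j ∈ T) :
    oneBlock x T (of j) = of x * of j * (of x)⁻¹ :=
  oneBlockHom_of_mem hx hT

lemma oneBlock_of_notMem {x j : J} {T : Set J} (hx : j ≠ x) (hT : j ∉ T) :
    oneBlock x T (of j) = of j :=
  oneBlockHom_of_notMem hx hT

lemma mulAut_ext {φ φ' : MulAut (FreeGroup J)} (h : ∀ j, φ (of j) = φ' (of j)) : φ = φ' :=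
  MulEquiv.toMonoidHom_injective (ext_hom _ _ h)

lemma congr_freeGroupCongr_oneBlock (ε : J ≃ K) {x : J} {T : Set J} {T' : Set K}
    (h : ∀ j, j ≠ x → (j ∈ T ↔ ε j ∈ T')) :
    MulAut.congr (freeGroupCongr ε) (oneBlock x T) = oneBlock (ε x) T' := by
  refine mulAut_ext fun k => ?_
  obtain ⟨j, rfl⟩ := ε.surjective k
  by_cases hx : j = x
  · subst hx
    simp [MulAut.congr]
  · have hx' : ε j ≠ ε x := fun h => hx (ε.injective h)
    by_cases hT : j ∈ T
    · simp [MulAut.congr, oneBlock_of_mem hx hT, oneBlock_of_mem hx' ((h j hx).1 hT)]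
    · simp [MulAut.congr, oneBlock_of_notMem hx hT,
        oneBlock_of_notMem hx' (fun h' => hT ((h j hx).2 h'))]

/-- Up to an inner automorphism, the conjugated and the fixed generators may be exchanged. -/
lemma congr_oneBlock_compl (x : J) (T : Set J) :
    MulAut.congr (oneBlock x ∅) (oneBlock x T) = MulAut.conj (of x)⁻¹ * oneBlock x Tᶜ := by
  have hsymm : ∀ a, (oneBlock x ∅).symm a = oneBlock x ∅ a := fun _ => rfl
  refine mulAut_ext fun j => ?_
  by_cases hx : j = x
  · subst hx
    simp [MulAut.congr, hsymm]
  · have h0 := oneBlock_of_notMem hx (Set.notMem_empty j)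
    by_cases hT : j ∈ T
    · simp [MulAut.congr, hsymm, h0, oneBlock_of_mem hx hT,
        oneBlock_of_notMem hx (Set.notMem_compl_iff.2 hT)]
    · simp [MulAut.congr, hsymm, h0, oneBlock_of_notMem hx hT,
        oneBlock_of_mem hx (Set.mem_compl hT), mul_assoc]

end OneBlock

end FreeGroup

section Outer

variable {G H K : Type*} [Group G] [Group H] [Group K]

lemma toOut_conj_mul (w : G) (φ : MulAut G) : toOut (MulAut.conj w * φ) = toOut φ := by
  have : toOut (MulAut.conj w) = 1 := (QuotientGroup.eq_one_iff _).2 ⟨w, rfl⟩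
  rw [_root_.map_mul, this, one_mul]

/-- Automorphisms of isomorphic groups transported to `K` have conjugate outer classes exactly
if some isomorphism carries one to the other up to an inner automorphism. -/
lemma isConj_toOut_congr_iff (e : G ≃* K) (e' : H ≃* K) (φ : MulAut G) (φ' : MulAut H) :
    IsConj (toOut (MulAut.congr e φ)) (toOut (MulAut.congr e' φ')) ↔
      ∃ (θ : G ≃* H) (w : H), MulAut.congr θ φ = MulAut.conj w * φ' := by
  rw [isConj_iff]
  constructor
  · rintro ⟨c, hc⟩
    obtain ⟨σ, rfl⟩ := QuotientGroup.mk'_surjective (Inn K) c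
    change toOut σ * _ * (toOut σ)⁻¹ = _ at hc
    rw [← _root_.map_inv, ← _root_.map_mul, ← _root_.map_mul, eq_comm] at hc
    obtain ⟨w, hw⟩ := QuotientGroup.eq.1 hc
    have hσ : σ * MulAut.congr e φ * σ⁻¹ = MulAut.congr e' φ' * MulAut.conj w := by
      rw [hw]; group
    refine ⟨(e.trans σ).trans e'.symm, φ' (e'.symm w), ?_⟩
    ext b
    have hb := congrArg e'.symm (DFunLike.congr_fun hσ (e' b))
    simpa [MulAut.congr] using hb
  · rintro ⟨θ, w, h⟩
    let σ : MulAut K := (e.symm.trans θ).trans e'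
    refine ⟨toOut σ, ?_⟩
    rw [← _root_.map_inv, ← _root_.map_mul, ← _root_.map_mul, ← toOut_conj_mul (e' w) (MulAut.congr e' φ')]
    congr 1
    ext b
    have hb := congrArg e' (DFunLike.congr_fun h (e'.symm b))
    simpa [MulAut.congr, σ] using hb

end Outer

namespace FreeGroup

variable {J X : Type*}

/-- The images of the generators under an isomorphism of free groups form a basis. -/
lemma isBasis_range (e : FreeGroup J ≃* FreeGroup X) :
    IsBasis (Set.range fun j => e (of j)) := by
  have hinj : Function.Injective fun j => e (of j) := e.injective.comp of_injective
  let ε := Equiv.ofInjective _ hinj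
  have : lift (fun s : Set.range (fun j => e (of j)) => (s : FreeGroup X)) =
      ((freeGroupCongr ε.symm).trans e).toMonoidHom := by
    ext1 s
    obtain ⟨j, rfl⟩ := ε.surjective s
    simp
    rfl
  unfold IsBasis
  rw [this]
  exact ((freeGroupCongr ε.symm).trans e).bijective

end FreeGroup

namespace SoftIndex

open FreeGroup

variable {P N : Type*} {A : P → Type*} {X : Type*}

lemma isCanonicalBasis_congr_soft (e : FreeGroup (SoftIndex P N A) ≃* FreeGroup X) :
    IsCanonicalBasis (MulAut.congr e (soft P N A)) (Set.range fun u => e (of (fix u)))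
      (Set.range fun p => e (of (pt p)))
      (fun g => {b | ∃ p y, g = e (of (pt p)) ∧ b = e (of (blk p y))}) := by
  have hinj : ∀ {j k : SoftIndex P N A}, e (of j) = e (of k) → j = k := fun h =>
    of_injective (e.injective h)
  refine ⟨⟨?_, ?_, ?_, ?_, ?_⟩, ?_, ?_, ?_⟩
  · convert isBasis_range e
    ext g
    simp only [Set.mem_union, Set.mem_range, Set.mem_iUnion, Set.mem_ofPred_eq]
    constructor
    · rintro ((⟨u, rfl⟩ | ⟨p, rfl⟩) | ⟨_, _, p, y, _, rfl⟩)
      exacts [⟨_, rfl⟩, ⟨_, rfl⟩, ⟨_, rfl⟩]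
    · rintro ⟨j, rfl⟩
      cases j with
      | fix u => exact Or.inl (Or.inl ⟨u, rfl⟩)
      | pt p => exact Or.inl (Or.inr ⟨p, rfl⟩)
      | blk p y => exact Or.inr ⟨_, ⟨p, rfl⟩, p, y, rfl, rfl⟩
  · rw [Set.disjoint_left]
    rintro _ ⟨u, rfl⟩ ⟨p, h⟩
    cases hinj h
  · rintro _ -
    rw [Set.disjoint_left]
    rintro _ ⟨u, rfl⟩ ⟨p, y, -, h⟩
    cases hinj h
  · rintro _ -
    rw [Set.disjoint_left]
    rintro _ ⟨u, rfl⟩ ⟨p, y, -, h⟩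
    cases hinj h
  · rintro _ - _ - hne
    rw [Set.disjoint_left]
    rintro _ ⟨p, y, rfl, rfl⟩ ⟨p', y', rfl, h⟩
    cases hinj h
    exact hne rfl
  · rintro _ ⟨u, rfl⟩
    simp [MulAut.congr]
  · rintro _ ⟨u, rfl⟩
    simp [MulAut.congr]
  · rintro _ - _ ⟨p, y, rfl, rfl⟩
    simp [MulAut.congr]

lemma isSoftOutInvolution_congr_soft [Nonempty P]
    (e : FreeGroup (SoftIndex P N A) ≃* FreeGroup X) :
    IsSoftOutInvolution (toOut (MulAut.congr e (soft P N A))) := by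
  have hsq : MulAut.congr e (soft P N A) ^ 2 = 1 := by
    rw [← _root_.map_pow, soft_sq, _root_.map_one]
  have hne : toOut (MulAut.congr e (soft P N A)) ≠ 1 := by
    intro h
    have hconj : IsConj (toOut (MulAut.congr e (soft P N A)))
        (toOut (MulAut.congr (MulEquiv.refl _) (1 : MulAut (FreeGroup X)))) := by
      rw [h, _root_.map_one, _root_.map_one]
    obtain ⟨θ, w, hw⟩ := (isConj_toOut_congr_iff _ _ _ _).1 hconj
    apply toOut_soft_ne_one (P := P) (N := N) (A := A)
    refine (QuotientGroup.eq_one_iff _).2 ⟨θ.symm w, ?_⟩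
    ext1 a
    have ha := congrArg θ.symm (DFunLike.congr_fun hw (θ a))
    simpa [MulAut.congr] using ha.symm
  refine ⟨⟨hne, by rw [← _root_.map_pow, hsq, _root_.map_one]⟩, _, ⟨⟨?_, hsq⟩, _, _, _,
    isCanonicalBasis_congr_soft e⟩, rfl⟩
  intro h
  exact hne (by rw [h, _root_.map_one])

lemma soft_bool_eq_mul {A : Bool → Type*} :
    soft Bool N A = oneBlock (pt true) (Set.range (blk true)) *
      oneBlock (pt false) (Set.range (blk false)) := by
  refine mulAut_ext fun j => ?_
  rw [MulAut.mul_apply]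
  cases j with
  | fix u => rw [soft_fix, oneBlock_of_notMem (by simp) (by simp),
      oneBlock_of_notMem (by simp) (by simp)]
  | pt p =>
    cases p
    · rw [soft_pt, oneBlock_self, _root_.map_inv, oneBlock_of_notMem (by simp) (by simp)]
    · rw [soft_pt, oneBlock_of_notMem (by simp) (by simp), oneBlock_self]
  | blk p y =>
    cases p
    · rw [soft_blk, oneBlock_of_mem (by simp) (by simp), _root_.map_mul, _root_.map_mul,
        _root_.map_inv, oneBlock_of_notMem (by simp) (by simp),
        oneBlock_of_notMem (by simp) (by simp)]
    · rw [soft_blk, oneBlock_of_notMem (by simp) (by simp), oneBlock_of_mem (by simp) (by simp)]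

end SoftIndex

/-- A basis enumerated injectively gives an isomorphism of free groups. -/
lemma FreeGroup.IsBasis.lift_bijective {J X : Type*} {S : Set (FreeGroup X)}
    (hS : FreeGroup.IsBasis S) {g : J → FreeGroup X} (hg : Function.Injective g)
    (hrange : Set.range g = S) : Function.Bijective (FreeGroup.lift g) := by
  subst hrange
  let ε := Equiv.ofInjective g hg
  have : FreeGroup.lift g = (FreeGroup.lift fun s : Set.range g => (s : FreeGroup X)).comp
      (FreeGroup.freeGroupCongr ε).toMonoidHom := by
    ext1 j
    simp [ε]
  rw [this]
  exact hS.comp (FreeGroup.freeGroupCongr ε).bijective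

lemma IsCanonicalBasis.exists_mulEquiv_oneBlock {X : Type*} {ψ : MulAut (FreeGroup X)}
    {V Y : Set (FreeGroup X)} {x : FreeGroup X} (hB : IsCanonicalBasis ψ V {x} (fun _ => Y)) :
    ∃ e : FreeGroup (Option (Y ⊕ V)) ≃* FreeGroup X,
      ψ = MulAut.congr e (FreeGroup.oneBlock none (Set.range (some ∘ Sum.inl))) := by
  obtain ⟨⟨hbasis, hVx, hVY, hxY, -⟩, hV, hx, hY⟩ := hB
  specialize hVY x rfl
  specialize hxY x rfl
  let g : Option (Y ⊕ V) → FreeGroup X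
    | none => x
    | some (.inl y) => y
    | some (.inr v) => v
  have hxV' : x ∉ V := Set.disjoint_singleton_right.1 hVx
  have hxY' : x ∉ Y := Set.disjoint_singleton_left.1 hxY
  have hVY' : ∀ v ∈ V, v ∉ Y := fun _ hv => Set.disjoint_left.1 hVY hv
  have hg : Function.Injective g := by
    rintro (_ | y | v) (_ | y' | v') (h : _ = _)
    · rfl
    · exact (ne_of_mem_of_not_mem y'.2 hxY' h.symm).elim
    · exact (ne_of_mem_of_not_mem v'.2 hxV' h.symm).elim
    · exact (ne_of_mem_of_not_mem y.2 hxY' h).elim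
    · rw [Subtype.ext h]
    · exact (ne_of_mem_of_not_mem y.2 (hVY' _ v'.2) h).elim
    · exact (ne_of_mem_of_not_mem v.2 hxV' h).elim
    · exact (ne_of_mem_of_not_mem y'.2 (hVY' _ v.2) h.symm).elim
    · rw [Subtype.ext h]
  have hrange : Set.range g = V ∪ {x} ∪ ⋃ z ∈ ({x} : Set (FreeGroup X)), Y := by
    ext b
    simp only [Set.mem_range, Set.mem_union, Set.mem_singleton_iff, Set.mem_iUnion, exists_prop,
      exists_eq_left]
    constructor
    · rintro ⟨_ | ⟨y, hy⟩ | ⟨v, hv⟩, rfl⟩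
      exacts [Or.inl (Or.inr rfl), Or.inr hy, Or.inl (Or.inl hv)]
    · rintro ((hb | rfl) | hb)
      exacts [⟨some (.inr ⟨b, hb⟩), rfl⟩, ⟨none, rfl⟩, ⟨some (.inl ⟨b, hb⟩), rfl⟩]
  let e := MulEquiv.ofBijective _ (hbasis.lift_bijective hg hrange)
  have he : ∀ j, e (FreeGroup.of j) = g j := fun j => FreeGroup.lift_apply_of
  refine ⟨e, ((MulAut.congr e).symm_apply_eq).1 (FreeGroup.mulAut_ext fun j => ?_)⟩
  apply e.injective
  have hlhs : e ((MulAut.congr e).symm ψ (FreeGroup.of j)) = ψ (g j) := by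
    rw [← he]
    simp [MulAut.congr]
  rw [hlhs]
  rcases j with _ | y | v
  · rw [FreeGroup.oneBlock_self, _root_.map_inv, he]
    exact hx x rfl
  · rw [FreeGroup.oneBlock_of_mem (by simp) (by simp), _root_.map_mul, _root_.map_mul,
      _root_.map_inv, he, he]
    exact hY x rfl y y.2
  · rw [FreeGroup.oneBlock_of_notMem (by simp) (by simp), he]
    exact hV v v.2

lemma nonempty_equiv_sum_of_infinite (N : Type) [Finite N] (A : Type*) [Infinite A] :
    Nonempty (A ≃ N ⊕ A) := by
  refine Cardinal.eq.1 ?_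
  rw [Cardinal.mk_sum, Cardinal.lift_uzero]
  have hA := Cardinal.aleph0_le_mk A
  exact (Cardinal.add_eq_right hA
    ((Cardinal.lift_lt_aleph0.2 (Cardinal.lt_aleph0_of_finite N)).le.trans hA)).symm

namespace SoftIndex

open FreeGroup

variable {N : Type*} {A : Bool → Type*}

/-- `SoftIndex Bool N A` with the block of `true` singled out. -/
def equivOptionTrue : SoftIndex Bool N A ≃ Option (A true ⊕ ((N ⊕ Unit) ⊕ A false)) where
  toFun
    | fix u => some (.inr (.inl (.inl u)))
    | pt true => none
    | pt false => some (.inr (.inl (.inr ())))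
    | blk true y => some (.inl y)
    | blk false y => some (.inr (.inr y))
  invFun
    | none => pt true
    | some (.inl y) => blk true y
    | some (.inr (.inl (.inl u))) => fix u
    | some (.inr (.inl (.inr ()))) => pt false
    | some (.inr (.inr y)) => blk false y
  left_inv := by rintro (_ | (_ | _) | ⟨_ | _, _⟩) <;> rfl
  right_inv := by rintro (_ | _ | (_ | _) | _) <;> rfl

/-- `SoftIndex Bool N A` with the block of `false` singled out. -/
def equivOptionFalse : SoftIndex Bool N A ≃ Option (((N ⊕ Unit) ⊕ A true) ⊕ A false) where
  toFun
    | fix u => some (.inl (.inl (.inl u)))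
    | pt true => some (.inl (.inl (.inr ())))
    | pt false => none
    | blk true y => some (.inl (.inr y))
    | blk false y => some (.inr y)
  invFun
    | none => pt false
    | some (.inl (.inl (.inl u))) => fix u
    | some (.inl (.inl (.inr ()))) => pt true
    | some (.inl (.inr y)) => blk true y
    | some (.inr y) => blk false y
  left_inv := by rintro (_ | (_ | _) | ⟨_ | _, _⟩) <;> rfl
  right_inv := by rintro (_ | ((_ | _) | _) | _) <;> rfl

/-- Both one-block factors of `soft Bool N A` are conjugate to the same `1`-involution. -/
lemma exists_mulEquiv_mem_mul {N : Type} [Finite N] {A : Bool → Type*} [∀ p, Infinite (A p)]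
    {X : Type*} (e : FreeGroup (Option (A true ⊕ A false)) ≃* FreeGroup X) :
    ∃ e' : FreeGroup (SoftIndex Bool N A) ≃* FreeGroup X,
      toOut (MulAut.congr e' (soft Bool N A)) ∈
        ({g | IsConj (toOut (MulAut.congr e (oneBlock none (Set.range (some ∘ Sum.inl))))) g} *
        {g | IsConj (toOut (MulAut.congr e (oneBlock none (Set.range (some ∘ Sum.inl))))) g} :
          Set (OutAut (FreeGroup X))) := by
  obtain ⟨αf⟩ := nonempty_equiv_sum_of_infinite (N ⊕ Unit) (A false)
  obtain ⟨αt⟩ := nonempty_equiv_sum_of_infinite (N ⊕ Unit) (A true)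
  let ε₁ : Option (A true ⊕ A false) ≃ SoftIndex Bool N A :=
    (Equiv.optionCongr (Equiv.sumCongr (Equiv.refl _) αf)).trans equivOptionTrue.symm
  let ε₂ : Option (A true ⊕ A false) ≃ SoftIndex Bool N A :=
    (Equiv.optionCongr (Equiv.sumCongr αt (Equiv.refl _))).trans equivOptionFalse.symm
  refine ⟨(freeGroupCongr ε₁).symm.trans e, ?_⟩
  rw [soft_bool_eq_mul, _root_.map_mul, _root_.map_mul]
  refine Set.mul_mem_mul ?_ ?_
  · refine (isConj_toOut_congr_iff _ _ _ _).2 ⟨freeGroupCongr ε₁, 1, ?_⟩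
    rw [_root_.map_one, one_mul]
    refine congr_freeGroupCongr_oneBlock ε₁ fun j hj => ?_
    rcases j with _ | y | v
    · exact absurd rfl hj
    · exact iff_of_true ⟨y, rfl⟩ ⟨y, rfl⟩
    · refine iff_of_false (by simp) ?_
      rintro ⟨y, hy⟩
      have h := congrArg equivOptionTrue hy
      rw [Equiv.trans_apply, Equiv.apply_symm_apply] at h
      simp [equivOptionTrue] at h
  · refine (isConj_toOut_congr_iff _ _ _ _).2
      ⟨(freeGroupCongr ε₂).trans (oneBlock (pt false) ∅), (of (pt false))⁻¹, ?_⟩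
    have h := congr_freeGroupCongr_oneBlock ε₂ (x := none) (T := Set.range (some ∘ Sum.inl))
      (T' := (Set.range (blk false))ᶜ) fun j hj => by
        rcases j with _ | y | v
        · exact absurd rfl hj
        · refine iff_of_true ⟨y, rfl⟩ ?_
          rintro ⟨y', hy⟩
          have h := congrArg equivOptionFalse hy
          rw [Equiv.trans_apply, Equiv.apply_symm_apply] at h
          simp [equivOptionFalse] at h
        · exact iff_of_false (by simp) (Set.notMem_compl_iff.2 ⟨v, rfl⟩)
    have h' := congr_oneBlock_compl (pt false) (Set.range (blk (N := N) (A := A) false))ᶜ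
    rw [compl_compl] at h'
    rw [← h']
    exact congrArg (MulAut.congr (oneBlock (pt false) ∅)) h

end SoftIndex

/-- Let `ψ ∈ Aut F` be a `1`-involution with canonical basis `V ⊔ {x} ⊔ Y`, where
`|Y| + 1 ≤ |V|` and `Y` is infinite, and let `L` be the conjugacy class of `ψ̂` in
`Out F`. Then `L·L` contains infinitely many conjugacy classes of soft involutions of
`Out F`; in particular, `L·L` contains more than one conjugacy class of involutions. -/
theorem infinitely_many_classes_in_square (X : Type*) [Infinite X]
    (ψ : MulAut (FreeGroup X)) (hψ : IsInvolution ψ)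
    (V Y : Set (FreeGroup X)) (x : FreeGroup X)
    (hB : IsCanonicalBasis ψ V {x} (fun _ => Y))
    (hcard : Cardinal.mk Y + 1 ≤ Cardinal.mk V)
    (hYinf : Y.Infinite)
    (L : Set (OutAut (FreeGroup X)))
    (hL : L = {g | IsConj (toOut ψ) g}) :
    (∃ f : ℕ → OutAut (FreeGroup X),
      (∀ n : ℕ, f n ∈ L * L ∧ IsSoftOutInvolution (f n)) ∧
      ∀ m n : ℕ, m ≠ n → ¬ IsConj (f m) (f n)) ∧
    (∃ c d : OutAut (FreeGroup X), c ∈ L * L ∧ d ∈ L * L ∧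
      IsInvolution c ∧ IsInvolution d ∧ ¬ IsConj c d) := by
  have hVinf : V.Infinite := by
    rw [← Set.infinite_coe_iff, Cardinal.infinite_iff] at hYinf ⊢
    exact hYinf.trans (le_self_add.trans hcard)
  let A : Bool → Type _ := fun p => if p then Y else V
  have : ∀ p, Infinite (A p) := by
    rintro (_ | _)
    exacts [hVinf.to_subtype, hYinf.to_subtype]
  obtain ⟨e, he⟩ : ∃ e : FreeGroup (Option (A true ⊕ A false)) ≃* FreeGroup X,
      ψ = MulAut.congr e (FreeGroup.oneBlock none (Set.range (some ∘ Sum.inl))) :=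
    hB.exists_mulEquiv_oneBlock
  have hmodel : ∀ n : ℕ, ∃ e' : FreeGroup (SoftIndex Bool (Fin (n + 1)) A) ≃* FreeGroup X,
      toOut (MulAut.congr e' (SoftIndex.soft Bool (Fin (n + 1)) A)) ∈ L * L := by
    intro n
    subst hL he
    exact SoftIndex.exists_mulEquiv_mem_mul e
  choose e' he' using hmodel
  have hsoft : ∀ n, IsSoftOutInvolution
      (toOut (MulAut.congr (e' n) (SoftIndex.soft Bool (Fin (n + 1)) A))) := fun n =>
    SoftIndex.isSoftOutInvolution_congr_soft (e' n)
  have hconj : ∀ m n : ℕ, m ≠ n →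
      ¬ IsConj (toOut (MulAut.congr (e' m) (SoftIndex.soft Bool (Fin (m + 1)) A)))
        (toOut (MulAut.congr (e' n) (SoftIndex.soft Bool (Fin (n + 1)) A))) := by
    intro m n hmn h
    obtain ⟨θ, w, hw⟩ := (isConj_toOut_congr_iff _ _ _ _).1 h
    have := SoftIndex.card_fixed_part_eq θ hw
    simp at this
    exact hmn this
  exact ⟨⟨_, fun n => ⟨he' n, hsoft n⟩, hconj⟩,
    _, _, he' 0, he' 1, (hsoft 0).1, (hsoft 1).1, hconj 0 1 zero_ne_one⟩
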